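/- arXiv:2507.06030 — 10 statements merged into one kernel-verified Lean document; each statement's English description precedes it below -/
import Mathlib

section
/- The Fisher difference f is jointly convex on the closed positive quadrant: for all x, y, x', y' ≥ 0 and all t ∈ [0,1], f(t·x + (1−t)·x', t·y + (1−t)·y') ≤ t·f(x,y) + (1−t)·f(x',y'). -/
/-- The Fisher difference `f(x,y) = (x-y)^2/(x+y)`, with `f(0,0) = 0`
(automatic since division by zero is zero in Lean). -/
noncomputable def fisherDiff (x y : ℝ) : ℝ := (x - y) ^ 2 / (x + y)

/-- The tangent planes of `fisherDiff` lie below it. -/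
theorem le_fisherDiff {x y : ℝ} (hx : 0 ≤ x) (hy : 0 ≤ y) (c : ℝ) :
    2 * c * (x - y) - c ^ 2 * (x + y) ≤ fisherDiff x y := by
  unfold fisherDiff
  rcases (add_nonneg hx hy).eq_or_lt with h | h
  · obtain rfl : x = 0 := by linarith
    obtain rfl : y = 0 := by linarith
    simp
  · rw [le_div_iff₀ h]
    nlinarith [sq_nonneg (x - y - c * (x + y))]

/-- `fisherDiff` agrees at `(x, y)` with its tangent plane of slope `(x - y) / (x + y)`. -/
theorem fisherDiff_eq (x y : ℝ) :
    fisherDiff x y =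
      2 * ((x - y) / (x + y)) * (x - y) - ((x - y) / (x + y)) ^ 2 * (x + y) := by
  unfold fisherDiff
  rcases eq_or_ne (x + y) 0 with h | h
  · simp [h]
  · field_simp
    ring

/-- The Fisher difference is jointly convex on the closed positive quadrant. -/
theorem fisherDiff_jointly_convex (x y x' y' t : ℝ)
    (hx : 0 ≤ x) (hy : 0 ≤ y) (hx' : 0 ≤ x') (hy' : 0 ≤ y')
    (ht0 : 0 ≤ t) (ht1 : t ≤ 1) :
    fisherDiff (t * x + (1 - t) * x') (t * y + (1 - t) * y') ≤
      t * fisherDiff x y + (1 - t) * fisherDiff x' y' := by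
  rw [fisherDiff_eq (t * x + (1 - t) * x')]
  generalize (t * x + (1 - t) * x' - (t * y + (1 - t) * y')) /
    (t * x + (1 - t) * x' + (t * y + (1 - t) * y')) = c
  have h := mul_le_mul_of_nonneg_left (le_fisherDiff hx hy c) ht0
  have h' := mul_le_mul_of_nonneg_left (le_fisherDiff hx' hy' c) (sub_nonneg.2 ht1)
  linarith
end

section
/- Universal upper bound on latent coherence: for every probability distribution p on ℕ with finite mean M(p) and every r ≥ 0, C_r(p) ≤ (1+r)·M(p) + r; moreover if r > 0, equality holds if and only if p_n · p_{n−1} = 0 for every n ≥ 1. -/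
/-- The latent coherence `C_r(p) = ∑_{n≥1} f(p_n, r p_{n-1}) n`. -/
noncomputable def latentCoh (r : ℝ) (p : ℕ → ℝ) : ℝ :=
  ∑' n : ℕ, fisherDiff (p (n + 1)) (r * p n) * (n + 1 : ℝ)

theorem fisherDiff_nonneg {x y : ℝ} (hx : 0 ≤ x) (hy : 0 ≤ y) : 0 ≤ fisherDiff x y :=
  div_nonneg (sq_nonneg _) (add_nonneg hx hy)

theorem fisherDiff_le_add {x y : ℝ} (hx : 0 ≤ x) (hy : 0 ≤ y) : fisherDiff x y ≤ x + y :=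
  div_le_of_le_mul₀ (add_nonneg hx hy) (add_nonneg hx hy)
    (by nlinarith [mul_nonneg hx hy])

theorem fisherDiff_eq_add_iff {x y : ℝ} (hx : 0 ≤ x) (hy : 0 ≤ y) :
    fisherDiff x y = x + y ↔ x * y = 0 := by
  rcases (add_nonneg hx hy).eq_or_lt with h | h
  · obtain rfl : x = 0 := by linarith
    obtain rfl : y = 0 := by linarith
    simp [fisherDiff]
  · rw [fisherDiff, div_eq_iff h.ne']
    constructor <;> intro h <;> linarith

/-- The majorant of the latent coherence obtained by replacing `f(x,y)` with `x+y`. -/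
theorem hasSum_fisherDiff_majorant (r : ℝ) {p : ℕ → ℝ} (hp1 : HasSum p 1)
    (hmean : Summable fun n : ℕ => (n : ℝ) * p n) :
    HasSum (fun n : ℕ => (p (n + 1) + r * p n) * (n + 1 : ℝ))
      ((1 + r) * (∑' n : ℕ, (n : ℝ) * p n) + r) := by
  have hshift : HasSum (fun n : ℕ => ((n + 1 : ℕ) : ℝ) * p (n + 1))
      (∑' n : ℕ, (n : ℝ) * p n) := by
    simpa using (hasSum_nat_add_iff' 1).mpr hmean.hasSum
  convert hshift.add ((hmean.hasSum.add hp1).mul_left r) using 1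
  · funext n
    push_cast
    ring
  · ring

/-- Universal upper bound on the latent coherence, with the equality condition
for positive background temperature. -/
theorem latentCoh_le_and_eq_iff (r : ℝ) (hr : 0 ≤ r) (p : ℕ → ℝ)
    (hp : ∀ n, 0 ≤ p n) (hp1 : ∑' n : ℕ, p n = 1)
    (hmean : Summable fun n : ℕ => (n : ℝ) * p n) :
    latentCoh r p ≤ (1 + r) * (∑' n : ℕ, (n : ℝ) * p n) + r ∧
      (0 < r →
        (latentCoh r p = (1 + r) * (∑' n : ℕ, (n : ℝ) * p n) + r ↔
          ∀ n : ℕ, 1 ≤ n → p n * p (n - 1) = 0)) := by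
  have hsum : HasSum p 1 := by
    have hs : Summable p := by
      by_contra h
      simp [tsum_eq_zero_of_not_summable h] at hp1
    simpa [hp1] using hs.hasSum
  have hmaj := hasSum_fisherDiff_majorant r hsum hmean
  have hrp (n : ℕ) : 0 ≤ r * p n := mul_nonneg hr (hp n)
  have hpos (n : ℕ) : (0 : ℝ) < n + 1 := by positivity
  have hle (n : ℕ) : fisherDiff (p (n + 1)) (r * p n) * (n + 1 : ℝ) ≤
      (p (n + 1) + r * p n) * (n + 1 : ℝ) :=
    mul_le_mul_of_nonneg_right (fisherDiff_le_add (hp _) (hrp n)) (hpos n).le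
  have hcoh : HasSum (fun n : ℕ => fisherDiff (p (n + 1)) (r * p n) * (n + 1 : ℝ))
      (latentCoh r p) :=
    (Summable.of_nonneg_of_le
      (fun n => mul_nonneg (fisherDiff_nonneg (hp _) (hrp n)) (hpos n).le)
      hle hmaj.summable).hasSum
  have hterm (hr0 : 0 < r) (n : ℕ) : fisherDiff (p (n + 1)) (r * p n) * (n + 1 : ℝ) =
      (p (n + 1) + r * p n) * (n + 1 : ℝ) ↔ p (n + 1) * p n = 0 := by
    rw [mul_left_inj' (hpos n).ne', fisherDiff_eq_add_iff (hp _) (hrp n), mul_left_comm,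
      mul_eq_zero, or_iff_right hr0.ne']
  refine ⟨hasSum_le hle hcoh hmaj, fun hr0 => ⟨fun heq n hn => ?_, fun h => ?_⟩⟩
  · obtain ⟨m, rfl⟩ := Nat.exists_eq_add_of_le' hn
    rw [Nat.add_sub_cancel]
    by_contra hne
    have hlt := lt_of_le_of_ne (hle m) fun h => hne ((hterm hr0 m).mp h)
    exact (hasSum_lt hle hlt hcoh hmaj).ne heq
  · refine hcoh.unique ?_
    convert hmaj using 2 with n
    exact (hterm hr0 n).mpr (h (n + 1) (Nat.le_add_left 1 n))
end

section
/- Vanishing latent coherence characterizes the thermal (geometric) distribution: for 0 < r < 1 and a probability distribution p on ℕ with finite mean, C_r(p) = 0 if and only if p_n = (1−r)·rⁿ for all n ∈ ℕ. -/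
@[simp]
theorem fisherDiff_self (x : ℝ) : fisherDiff x x = 0 := by
  simp [fisherDiff]

theorem fisherDiff_eq_zero_iff {x y : ℝ} (hx : 0 ≤ x) (hy : 0 ≤ y) :
    fisherDiff x y = 0 ↔ x = y := by
  refine ⟨fun h => ?_, fun h => by rw [h, fisherDiff_self]⟩
  rcases div_eq_zero_iff.mp h with h | h
  · exact sub_eq_zero.mp (pow_eq_zero_iff two_ne_zero |>.mp h)
  · linarith

/-- The series defining the latent coherence of a nonnegative sequence with finite total mass
and finite mean converges. -/
theorem summable_latentCoh {r : ℝ} (hr : 0 ≤ r) {p : ℕ → ℝ} (hp : ∀ n, 0 ≤ p n)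
    (hsum : Summable p) (hmean : Summable fun n : ℕ => (n : ℝ) * p n) :
    Summable fun n : ℕ => fisherDiff (p (n + 1)) (r * p n) * (n + 1 : ℝ) := by
  have hbound : Summable fun n : ℕ =>
      ((n + 1 : ℕ) : ℝ) * p (n + 1) + r * ((n : ℝ) * p n + p n) :=
    ((summable_nat_add_iff 1).mpr hmean).add ((hmean.add hsum).mul_left r)
  refine hbound.of_nonneg_of_le (fun n => ?_) fun n => ?_
  · exact mul_nonneg (fisherDiff_nonneg (hp _) (mul_nonneg hr (hp _))) (by positivity)
  · calc fisherDiff (p (n + 1)) (r * p n) * (n + 1 : ℝ)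
        ≤ (p (n + 1) + r * p n) * (n + 1 : ℝ) :=
          mul_le_mul_of_nonneg_right (fisherDiff_le_add (hp _) (mul_nonneg hr (hp _)))
            (by positivity)
      _ = ((n + 1 : ℕ) : ℝ) * p (n + 1) + r * ((n : ℝ) * p n + p n) := by
          push_cast
          ring

theorem latentCoh_eq_zero_iff_forall_succ {r : ℝ} (hr : 0 ≤ r) {p : ℕ → ℝ} (hp : ∀ n, 0 ≤ p n)
    (hsum : Summable p) (hmean : Summable fun n : ℕ => (n : ℝ) * p n) :
    latentCoh r p = 0 ↔ ∀ n, p (n + 1) = r * p n := by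
  have hs := summable_latentCoh hr hp hsum hmean
  have hnn (n : ℕ) : 0 ≤ fisherDiff (p (n + 1)) (r * p n) * (n + 1 : ℝ) :=
    mul_nonneg (fisherDiff_nonneg (hp _) (mul_nonneg hr (hp _))) (by positivity)
  rw [latentCoh, ← hs.hasSum_iff, hasSum_zero_iff_of_nonneg hnn, funext_iff]
  refine forall_congr' fun n => ?_
  have hn : (n + 1 : ℝ) ≠ 0 := by positivity
  simp [hn, fisherDiff_eq_zero_iff (hp _) (mul_nonneg hr (hp n))]

/-- Vanishing latent coherence characterizes the thermal (geometric) distribution. -/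
theorem latentCoh_eq_zero_iff_geometric (r : ℝ) (hr0 : 0 < r) (hr1 : r < 1)
    (p : ℕ → ℝ) (hp : ∀ n, 0 ≤ p n) (hp1 : ∑' n : ℕ, p n = 1)
    (hmean : Summable fun n : ℕ => (n : ℝ) * p n) :
    latentCoh r p = 0 ↔ ∀ n : ℕ, p n = (1 - r) * r ^ n := by
  have hsum : Summable p := by
    by_contra h
    simp [tsum_eq_zero_of_not_summable h] at hp1
  rw [latentCoh_eq_zero_iff_forall_succ hr0.le hp hsum hmean]
  constructor
  · intro h
    have hgeom (n : ℕ) : p n = p 0 * r ^ n := by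
      induction n with
      | zero => simp
      | succ k ih => rw [h, ih]; ring
    have hp0 : p 0 = 1 - r := by
      rw [tsum_congr hgeom, tsum_mul_left, tsum_geometric_of_lt_one hr0.le hr1,
        ← div_eq_mul_inv, div_eq_one_iff_eq (sub_pos.mpr hr1).ne'] at hp1
      exact hp1
    intro n
    rw [hgeom, hp0]
  · intro h n
    rw [h, h]
    ring
end

section
/- The latent coherence is convex in the probability distribution: for probability distributions p, q on ℕ with finite means, any t ∈ [0,1], and any r ≥ 0, C_r(t·p + (1−t)·q) ≤ t·C_r(p) + (1−t)·C_r(q). -/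
theorem fisherDiff_mul_mul (t x y : ℝ) :
    fisherDiff (t * x) (t * y) = t * fisherDiff x y := by
  unfold fisherDiff
  rcases eq_or_ne t 0 with rfl | ht
  · simp
  · rw [← mul_sub, ← mul_add, mul_pow, sq t, mul_assoc, mul_div_mul_left _ _ ht, mul_div_assoc]

/-- The Fisher difference is jointly subadditive on the nonnegative quadrant. -/
theorem fisherDiff_add_add_le {a b c d : ℝ} (ha : 0 ≤ a) (hb : 0 ≤ b) (hc : 0 ≤ c)
    (hd : 0 ≤ d) : fisherDiff (a + c) (b + d) ≤ fisherDiff a b + fisherDiff c d := by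
  rcases (add_nonneg ha hb).eq_or_lt with hab | hab
  · obtain rfl : a = 0 := by linarith
    obtain rfl : b = 0 := by linarith
    simp [fisherDiff]
  rcases (add_nonneg hc hd).eq_or_lt with hcd | hcd
  · obtain rfl : c = 0 := by linarith
    obtain rfl : d = 0 := by linarith
    simp [fisherDiff]
  unfold fisherDiff
  rw [div_add_div _ _ hab.ne' hcd.ne', div_le_div_iff₀ (by linarith) (by positivity)]
  nlinarith [sq_nonneg ((a - b) * (c + d) - (c - d) * (a + b))]

/-- Convexity of the latent coherence in the probability distribution. -/
theorem latentCoh_convex (r : ℝ) (hr : 0 ≤ r) (p q : ℕ → ℝ)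
    (hp : ∀ n, 0 ≤ p n) (hp1 : ∑' n : ℕ, p n = 1)
    (hq : ∀ n, 0 ≤ q n) (hq1 : ∑' n : ℕ, q n = 1)
    (hpmean : Summable fun n : ℕ => (n : ℝ) * p n)
    (hqmean : Summable fun n : ℕ => (n : ℝ) * q n)
    (t : ℝ) (ht0 : 0 ≤ t) (ht1 : t ≤ 1) :
    latentCoh r (fun n => t * p n + (1 - t) * q n) ≤
      t * latentCoh r p + (1 - t) * latentCoh r q := by
  have hs : 0 ≤ 1 - t := sub_nonneg.mpr ht1
  have summable_of_tsum {u : ℕ → ℝ} (hu : ∑' n, u n = 1) : Summable u := by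
    by_contra h
    simp [tsum_eq_zero_of_not_summable h] at hu
  have hps := summable_of_tsum hp1
  have hqs := summable_of_tsum hq1
  have hP := (summable_latentCoh hr hp hps hpmean).mul_left t
  have hQ := (summable_latentCoh hr hq hqs hqmean).mul_left (1 - t)
  have hmix := summable_latentCoh hr
    (p := fun n => t * p n + (1 - t) * q n)
    (fun n => add_nonneg (mul_nonneg ht0 (hp n)) (mul_nonneg hs (hq n)))
    ((hps.mul_left t).add (hqs.mul_left (1 - t)))
    (((hpmean.mul_left t).add (hqmean.mul_left (1 - t))).congr fun n => by ring)
  unfold latentCoh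
  rw [← tsum_mul_left, ← tsum_mul_left, ← hP.tsum_add hQ]
  refine hmix.tsum_le_tsum (fun n => ?_) (hP.add hQ)
  rw [← mul_assoc, ← mul_assoc, ← add_mul, ← fisherDiff_mul_mul, ← fisherDiff_mul_mul,
    mul_add r, mul_left_comm r t, mul_left_comm r (1 - t)]
  gcongr
  exact fisherDiff_add_add_le (mul_nonneg ht0 (hp _)) (mul_nonneg ht0 (mul_nonneg hr (hp _)))
    (mul_nonneg hs (hq _)) (mul_nonneg hs (mul_nonneg hr (hq _)))
end

section
/- Latent coherence increases with background temperature for sub-cold states: let p be a probability distribution on ℕ with finite mean and let 0 ≤ r₁ ≤ r₂ ≤ 1. If p_n ≤ r₁·p_{n−1} for every n ≥ 1, then C_{r₁}(p) ≤ C_{r₂}(p). -/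
theorem fisherDiff_le_fisherDiff_right {x y z : ℝ} (hx : 0 ≤ x) (hxy : x ≤ y) (hyz : y ≤ z) :
    fisherDiff x y ≤ fisherDiff x z := by
  rcases (add_nonneg hx (hx.trans hxy)).eq_or_lt with h | h
  · have : fisherDiff x y = 0 := by simp [fisherDiff, ← h]
    exact this ▸ fisherDiff_nonneg hx (hx.trans (hxy.trans hyz))
  · rw [fisherDiff, fisherDiff, div_le_div_iff₀ h (by linarith)]
    have h1 := mul_nonneg (mul_nonneg (sub_nonneg.2 hxy) (sub_nonneg.2 (hxy.trans hyz)))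
      (sub_nonneg.2 hyz)
    have h2 := mul_nonneg hx (mul_nonneg (sub_nonneg.2 hyz)
      (add_nonneg (sub_nonneg.2 hxy) (sub_nonneg.2 (hxy.trans hyz))))
    linarith

theorem summable_fisherDiff_mul {p : ℕ → ℝ} (hp : ∀ n, 0 ≤ p n) (hs : Summable p)
    (hmean : Summable fun n : ℕ => (n : ℝ) * p n) {r : ℝ} (hr : 0 ≤ r) :
    Summable fun n : ℕ => fisherDiff (p (n + 1)) (r * p n) * (n + 1 : ℝ) := by
  have hb := ((summable_nat_add_iff 1).2 hmean).add ((hmean.add hs).mul_left r)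
  refine hb.of_nonneg_of_le
    (fun n => mul_nonneg (fisherDiff_nonneg (hp _) (mul_nonneg hr (hp n))) (by positivity))
    fun n => ?_
  calc fisherDiff (p (n + 1)) (r * p n) * (n + 1 : ℝ)
      ≤ (p (n + 1) + r * p n) * (n + 1 : ℝ) := by
        gcongr
        exact fisherDiff_le_add (hp _) (mul_nonneg hr (hp n))
    _ = _ := by push_cast; ring

/-- For a state colder than the background with ratio `r₁`, the latent coherence
increases with the background temperature. -/
theorem latentCoh_mono_of_cold (p : ℕ → ℝ) (hp : ∀ n, 0 ≤ p n)
    (hp1 : ∑' n : ℕ, p n = 1) (hmean : Summable fun n : ℕ => (n : ℝ) * p n)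
    (r₁ r₂ : ℝ) (hr₁ : 0 ≤ r₁) (hr₁₂ : r₁ ≤ r₂) (hr₂ : r₂ ≤ 1)
    (hcold : ∀ n : ℕ, 1 ≤ n → p n ≤ r₁ * p (n - 1)) :
    latentCoh r₁ p ≤ latentCoh r₂ p := by
  have hs : Summable p := by
    by_contra h
    simp [tsum_eq_zero_of_not_summable h] at hp1
  refine (summable_fisherDiff_mul hp hs hmean hr₁).tsum_le_tsum (fun n => ?_)
    (summable_fisherDiff_mul hp hs hmean (hr₁.trans hr₁₂))
  have hn : p (n + 1) ≤ r₁ * p n := by simpa using hcold (n + 1) (by lia)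
  gcongr
  exact fisherDiff_le_fisherDiff_right (hp _) hn (mul_le_mul_of_nonneg_right hr₁₂ (hp n))
end

section
/- Latent coherence of a thermal state at a different temperature: for 0 < r' < 1 and r ≥ 0, the geometric distribution p_n = (1−r')·r'ⁿ satisfies C_r(p) = (r'−r)² / ((r'+r)·(1−r')). -/
/-- Latent coherence of a thermal (geometric) state at ratio `r'` relative to a
background with ratio `r`. -/
theorem latentCoh_thermal (r' r : ℝ) (hr'0 : 0 < r') (hr'1 : r' < 1) (hr : 0 ≤ r) :
    latentCoh r (fun n => (1 - r') * r' ^ n) =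
      (r' - r) ^ 2 / ((r' + r) * (1 - r')) := by
  have hnorm : ‖r'‖ < 1 := by rwa [Real.norm_of_nonneg hr'0.le]
  have hsum : HasSum (fun n : ℕ => (n : ℝ) * r' ^ n + r' ^ n)
      (r' / (1 - r') ^ 2 + (1 - r')⁻¹) :=
    (hasSum_coe_mul_geometric_of_norm_lt_one hnorm).add (hasSum_geometric_of_norm_lt_one hnorm)
  have h1 : 1 - r' ≠ 0 := (sub_pos.2 hr'1).ne'
  have h2 : r' + r ≠ 0 := (add_pos_of_pos_of_nonneg hr'0 hr).ne'
  have hterm (n : ℕ) :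
      fisherDiff ((1 - r') * r' ^ (n + 1)) (r * ((1 - r') * r' ^ n)) * (n + 1 : ℝ) =
        (1 - r') * (r' - r) ^ 2 / (r' + r) * ((n : ℝ) * r' ^ n + r' ^ n) := by
    have h3 : (1 - r') * r' ^ n ≠ 0 := mul_ne_zero h1 (pow_ne_zero n hr'0.ne')
    have h4 : (1 - r') * r' ^ (n + 1) + r * ((1 - r') * r' ^ n) =
        (1 - r') * r' ^ n * (r' + r) := by ring
    rw [fisherDiff, h4, pow_succ]
    field_simp
    ring
  simp only [latentCoh, hterm]
  rw [(hsum.mul_left _).tsum_eq]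
  field_simp
  ring
end

section
/- Integral formula for the latent coherence of Poisson statistics: for λ > 0 and 0 < r ≤ 1, the Poisson distribution p_n = e^{−λ}·λⁿ/n! satisfies C_r(p) = r·(λ+1) − 3λ + 4·λ/r − (4·λ²/r²)·∫₀¹ u^{λ/r − 1} · e^{λ(u−1)} du. -/
open MeasureTheory

theorem hasSum_poisson (l : ℝ) :
    HasSum (fun n : ℕ => Real.exp (-l) * l ^ n / (Nat.factorial n)) 1 := by
  have h := (NormedSpace.expSeries_div_hasSum_exp l).mul_left (Real.exp (-l))
  rw [← Real.exp_eq_exp_ℝ, ← Real.exp_add, neg_add_cancel, Real.exp_zero] at h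
  simpa only [mul_div_assoc] using h

theorem succ_mul_poisson_succ (l : ℝ) (n : ℕ) :
    ((n : ℝ) + 1) * (Real.exp (-l) * l ^ (n + 1) / (Nat.factorial (n + 1))) =
      l * (Real.exp (-l) * l ^ n / (Nat.factorial n)) := by
  rw [Nat.factorial_succ]
  have h : (Nat.factorial n : ℝ) ≠ 0 := by positivity
  have h' : (n : ℝ) + 1 ≠ 0 := by positivity
  push_cast
  field_simp
  ring

theorem hasSum_mul_poisson (l : ℝ) :
    HasSum (fun n : ℕ => (n : ℝ) * (Real.exp (-l) * l ^ n / (Nat.factorial n))) l := by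
  rw [← hasSum_nat_add_iff' 1]
  simp only [Finset.sum_range_one, Nat.cast_zero, zero_mul, sub_zero, Nat.cast_add, Nat.cast_one,
    succ_mul_poisson_succ]
  simpa using (hasSum_poisson l).mul_left l

theorem hasSum_poisson_div_add (l a : ℝ) (hl : 0 ≤ l) (ha : 0 < a) :
    HasSum (fun n : ℕ => Real.exp (-l) * l ^ n / (Nat.factorial n) / (a + n))
      (∫ u in Set.Ioc (0 : ℝ) 1, u ^ (a - 1) * Real.exp (l * (u - 1))) := by
  set p : ℕ → ℝ := fun n => Real.exp (-l) * l ^ n / (Nat.factorial n) with hp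
  have hp0 (n : ℕ) : 0 ≤ p n := by positivity
  have hgt (n : ℕ) : -1 < a - 1 + n := by
    have : (0 : ℝ) ≤ n := n.cast_nonneg
    linarith
  have hint (n : ℕ) :
      ∫ u in Set.Ioc (0 : ℝ) 1, p n * u ^ (a - 1 + n) = p n / (a + n) := by
    have hne : a + n ≠ 0 := by positivity
    rw [integral_const_mul, ← intervalIntegral.integral_of_le zero_le_one,
      integral_rpow (Or.inl (hgt n)), show a - 1 + n + 1 = a + n by ring, Real.one_rpow,
      Real.zero_rpow hne, sub_zero, mul_one_div]
  have hF (n : ℕ) : Integrable (fun u : ℝ => p n * u ^ (a - 1 + n))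
      (volume.restrict (Set.Ioc 0 1)) :=
    ((intervalIntegrable_iff_integrableOn_Ioc_of_le zero_le_one).1
      (intervalIntegral.intervalIntegrable_rpow' (hgt n))).const_mul _
  have hnorm (n : ℕ) :
      ∫ u in Set.Ioc (0 : ℝ) 1, ‖p n * u ^ (a - 1 + n)‖ = p n / (a + n) := by
    rw [← hint n]
    refine setIntegral_congr_fun measurableSet_Ioc fun u hu => ?_
    exact Real.norm_of_nonneg (mul_nonneg (hp0 n) (Real.rpow_nonneg hu.1.le _))
  have hsum : Summable fun n => p n / (a + n) := by
    refine Summable.of_nonneg_of_le (fun n => div_nonneg (hp0 n) (by positivity)) (fun n => ?_)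
      ((hasSum_poisson l).summable.div_const a)
    exact div_le_div_of_nonneg_left (hp0 n) ha (by simp)
  have key := hasSum_integral_of_summable_integral_norm hF (by simpa only [hnorm] using hsum)
  simp only [hint] at key
  have hexp : Set.EqOn (fun u : ℝ => u ^ (a - 1) * Real.exp (l * (u - 1)))
      (fun u => ∑' n, p n * u ^ (a - 1 + n)) (Set.Ioc 0 1) := fun u hu => by
    have h := ((hasSum_poisson (l * u)).mul_left
      (u ^ (a - 1) * Real.exp (l * (u - 1)))).tsum_eq
    dsimp only
    rw [mul_one] at h
    rw [← h]
    refine tsum_congr fun n => ?_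
    have he : Real.exp (l * (u - 1)) * Real.exp (-(l * u)) = Real.exp (-l) := by
      rw [← Real.exp_add]; ring_nf
    rw [Real.rpow_add hu.1, Real.rpow_natCast, hp]
    dsimp only
    rw [← he, mul_pow]
    ring
  rwa [setIntegral_congr_fun measurableSet_Ioc hexp]

/-- Integral formula for the latent coherence of Poisson statistics. -/
theorem latentCoh_poisson (l r : ℝ) (hl : 0 < l) (hr0 : 0 < r) (hr1 : r ≤ 1) :
    latentCoh r (fun n => Real.exp (-l) * l ^ n / (Nat.factorial n)) =
      r * (l + 1) - 3 * l + 4 * l / r -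
        (4 * l ^ 2 / r ^ 2) *
          ∫ u in Set.Ioc (0 : ℝ) 1, u ^ (l / r - 1) * Real.exp (l * (u - 1)) := by
  have hI := hasSum_poisson_div_add l (l / r) hl.le (by positivity)
  have h0 := hasSum_poisson l
  have h1 := hasSum_mul_poisson l
  have hrec := succ_mul_poisson_succ l
  have hpos (n : ℕ) : 0 < Real.exp (-l) * l ^ n / (Nat.factorial n) := by positivity
  generalize (∫ u in Set.Ioc (0 : ℝ) 1, u ^ (l / r - 1) * Real.exp (l * (u - 1))) = I at *
  unfold latentCoh
  generalize hp : (fun n : ℕ => Real.exp (-l) * l ^ n / (Nat.factorial n)) = p at *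
  have hpn (n : ℕ) : Real.exp (-l) * l ^ n / (Nat.factorial n) = p n := congrFun hp n
  simp only [hpn] at hI h1 hrec hpos
  have hshift := (hasSum_nat_add_iff' 1).2 (h0.sub (hI.mul_left (l / r)))
  have hlr : l / r ≠ 0 := by positivity
  simp only [Finset.sum_range_one, Nat.cast_zero, add_zero, mul_div_cancel₀ _ hlr] at hshift
  have hS := ((h1.mul_left r).add (h0.mul_left (r - 3 * l))).add (hshift.mul_left (4 * l / r))
  rw [HasSum.tsum_eq (a := _) (HasSum.congr_fun hS ?_)]
  · field_simp
    ring
  · intro n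
    have hq : p (n + 1) = l * p n / (n + 1) := by
      rw [← hrec n]; field_simp
    unfold fisherDiff
    have := hpos n
    rw [hq]
    push_cast
    have e : l * p n / (n + 1) + r * p n = p n * (l + r * (n + 1)) / (n + 1) := by field_simp
    have e' : l / r + (n + 1) = (l + r * (n + 1)) / r := by field_simp
    have e1 : l + r * (n + 1) ≠ 0 := by positivity
    rw [e, e']
    field_simp
    ring
end

section
/- Large-amplitude asymptotics of Poisson latent coherence: for fixed r ∈ (0,1], letting p^{(λ)} denote the Poisson distribution with mean λ, the limit as λ → ∞ of C_r(p^{(λ)}) − λ·(1−r)²/(1+r) exists and equals r·(1 − 4/(1+r)³). -/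
open Filter

/-- The Poisson weights with mean `l`. -/
noncomputable def poissonWeight (l : ℝ) (n : ℕ) : ℝ :=
  Real.exp (-l) * l ^ n / (Nat.factorial n)

lemma poissonWeight_succ (l : ℝ) (n : ℕ) :
    poissonWeight l (n + 1) = poissonWeight l n * (l / (n + 1)) := by
  have h : (Nat.factorial n : ℝ) ≠ 0 := by positivity
  have h' : (n + 1 : ℝ) ≠ 0 := by positivity
  simp only [poissonWeight, Nat.factorial_succ, Nat.cast_mul, Nat.cast_add, Nat.cast_one]
  field_simp
  ring

lemma poissonWeight_pos {l : ℝ} (hl : 0 < l) (n : ℕ) : 0 < poissonWeight l n := by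
  unfold poissonWeight
  positivity

/-- The `k`-th factorial moment of the Poisson distribution with mean `l` is `l ^ k`. -/
lemma hasSum_poissonWeight_mul_descFactorial (l : ℝ) (k : ℕ) :
    HasSum (fun n => poissonWeight l n * (n.descFactorial k : ℝ)) (l ^ k) := by
  induction k with
  | zero =>
    have h := (NormedSpace.expSeries_div_hasSum_exp l).mul_left (Real.exp (-l))
    rw [← Real.exp_eq_exp_ℝ, ← Real.exp_add, neg_add_cancel, Real.exp_zero] at h
    simpa [poissonWeight, mul_div_assoc] using h
  | succ k ih =>
    rw [← hasSum_nat_add_iff' 1]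
    simp only [Finset.range_one, Finset.sum_singleton, Nat.zero_descFactorial_succ,
      Nat.cast_zero, mul_zero, sub_zero]
    rw [pow_succ']
    refine (ih.mul_left l).congr_fun ?_
    intro n
    have h' : (n + 1 : ℝ) ≠ 0 := by positivity
    rw [poissonWeight_succ, Nat.succ_descFactorial_succ]
    push_cast
    field_simp

/-- Expectation of a quartic polynomial, in the factorial basis, under the Poisson distribution. -/
lemma hasSum_poissonWeight_mul_quartic (l c₀ c₁ c₂ c₃ c₄ : ℝ) :
    HasSum (fun n : ℕ => poissonWeight l n * (c₀ + c₁ * n + c₂ * (n * (n - 1)) +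
      c₃ * (n * (n - 1) * (n - 2)) + c₄ * (n * (n - 1) * (n - 2) * (n - 3))))
      (c₀ + c₁ * l + c₂ * l ^ 2 + c₃ * l ^ 3 + c₄ * l ^ 4) := by
  have h k := hasSum_poissonWeight_mul_descFactorial l k
  convert (((((h 0).mul_left c₀).add ((h 1).mul_left c₁)).add ((h 2).mul_left c₂)).add
    ((h 3).mul_left c₃)).add ((h 4).mul_left c₄) using 1
  · rfl
  · funext n
    simp only [← descPochhammer_eval_eq_descFactorial ℝ,
      descPochhammer_succ_right, descPochhammer_zero]
    simp
    ring
  · ring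

lemma fisherDiff_poissonWeight {l r : ℝ} (hl : 0 < l) (hr : 0 < r) (n : ℕ) :
    fisherDiff (poissonWeight l (n + 1)) (r * poissonWeight l n) * (n + 1 : ℝ) =
      poissonWeight l n * ((l - r * (n + 1)) ^ 2 / (l + r * (n + 1))) := by
  have hp := (poissonWeight_pos hl n).ne'
  have h' : (n + 1 : ℝ) ≠ 0 := by positivity
  have h'' : l + r * (n + 1) ≠ 0 := by positivity
  have e : poissonWeight l (n + 1) + r * poissonWeight l n =
      poissonWeight l n * (l + r * (n + 1)) / (n + 1) := by
    rw [poissonWeight_succ]; field_simp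
  rw [fisherDiff, e, poissonWeight_succ]
  field_simp

/-- The cubic Taylor polynomial of `m ↦ (l - r m) ^ 2 / (l + r m)` at `m = l`. -/
noncomputable def fisherTaylor (r l m : ℝ) : ℝ :=
  r * m - 3 * l + 4 * l ^ 2 * (1 / (l * (1 + r)) - r * (m - l) / (l * (1 + r)) ^ 2 +
    (r * (m - l)) ^ 2 / (l * (1 + r)) ^ 3 - (r * (m - l)) ^ 3 / (l * (1 + r)) ^ 4)

lemma sub_sq_div_add_eq_fisherTaylor_add {l r m : ℝ} (hl : 0 < l) (hr : 0 < r) (hm : 0 ≤ m) :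
    (l - r * m) ^ 2 / (l + r * m) =
      fisherTaylor r l m + 4 * l ^ 2 * (r * (m - l)) ^ 4 / ((l * (1 + r)) ^ 4 * (l + r * m)) := by
  have h : l + r * m ≠ 0 := by positivity
  have h' : 1 + r ≠ 0 := by positivity
  unfold fisherTaylor
  field_simp
  ring

lemma fisherTaylor_le {l r m : ℝ} (hl : 0 < l) (hr : 0 < r) (hm : 0 ≤ m) :
    fisherTaylor r l m ≤ (l - r * m) ^ 2 / (l + r * m) := by
  rw [sub_sq_div_add_eq_fisherTaylor_add hl hr hm]
  exact le_add_of_nonneg_right (by positivity)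

lemma le_fisherTaylor_add {l r m : ℝ} (hl : 0 < l) (hr : 0 < r) (hm : 0 ≤ m) :
    (l - r * m) ^ 2 / (l + r * m) ≤
      fisherTaylor r l m + 4 * l * (r * (m - l)) ^ 4 / (l * (1 + r)) ^ 4 := by
  rw [sub_sq_div_add_eq_fisherTaylor_add hl hr hm]
  have h : 4 * l * (r * (m - l)) ^ 4 / (l * (1 + r)) ^ 4 =
      4 * l ^ 2 * (r * (m - l)) ^ 4 / ((l * (1 + r)) ^ 4 * l) := by
    field_simp
  rw [h]
  gcongr
  exact le_add_of_nonneg_right (by positivity)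

lemma hasSum_poissonWeight_mul_fisherTaylor {l r : ℝ} (hl : 0 < l) (hr : 0 < r) :
    HasSum (fun n : ℕ => poissonWeight l n * fisherTaylor r l (n + 1))
      (l * (1 - r) ^ 2 / (1 + r) + (r - 4 * r / (1 + r) ^ 2 +
        4 * r ^ 2 * (1 + l⁻¹) / (1 + r) ^ 3 -
          4 * r ^ 3 * (4 * l⁻¹ + l⁻¹ ^ 2) / (1 + r) ^ 4)) := by
  set a := l * (1 + r) with ha
  have h' : 1 + r ≠ 0 := by positivity
  have h := hasSum_poissonWeight_mul_quartic l
    (r - 3 * l + 4 * l ^ 2 * (1 / a - r * (1 - l) / a ^ 2 + r ^ 2 * (1 - l) ^ 2 / a ^ 3 -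
      r ^ 3 * (1 - l) ^ 3 / a ^ 4))
    (r + 4 * l ^ 2 * (-r / a ^ 2 + r ^ 2 * (1 + 2 * (1 - l)) / a ^ 3 -
      r ^ 3 * (1 + 3 * (1 - l) + 3 * (1 - l) ^ 2) / a ^ 4))
    (4 * l ^ 2 * (r ^ 2 / a ^ 3 - r ^ 3 * (3 + 3 * (1 - l)) / a ^ 4))
    (4 * l ^ 2 * (-r ^ 3 / a ^ 4)) 0
  convert h using 1
  · funext n
    unfold fisherTaylor
    rw [← ha]
    ring
  · rw [ha]
    field_simp
    ring

lemma hasSum_poissonWeight_mul_remainder {l r : ℝ} (hl : 0 < l) (hr : 0 < r) :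
    HasSum (fun n : ℕ => poissonWeight l n *
        (4 * l * (r * ((n + 1 : ℝ) - l)) ^ 4 / (l * (1 + r)) ^ 4))
      (4 * r ^ 4 * (3 * l⁻¹ + 11 * l⁻¹ ^ 2 + l⁻¹ ^ 3) / (1 + r) ^ 4) := by
  have h' : 1 + r ≠ 0 := by positivity
  have h := (hasSum_poissonWeight_mul_quartic l ((1 - l) ^ 4)
    (1 + 4 * (1 - l) + 6 * (1 - l) ^ 2 + 4 * (1 - l) ^ 3)
    (7 + 12 * (1 - l) + 6 * (1 - l) ^ 2) (6 + 4 * (1 - l)) 1).mul_right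
      (4 * l * r ^ 4 / (l * (1 + r)) ^ 4)
  convert h using 1
  · rfl
  · funext n
    ring
  · field_simp
    ring

lemma hasSum_latentCoh_poissonWeight {l r : ℝ} (hl : 0 < l) (hr : 0 < r) :
    HasSum (fun n : ℕ => poissonWeight l n * ((l - r * (n + 1)) ^ 2 / (l + r * (n + 1))))
      (latentCoh r (poissonWeight l)) := by
  rw [latentCoh, tsum_congr (fisherDiff_poissonWeight hl hr)]
  refine Summable.hasSum (((hasSum_poissonWeight_mul_fisherTaylor hl hr).add
    (hasSum_poissonWeight_mul_remainder hl hr)).summable.of_nonneg_of_le (fun n => ?_)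
      fun n => ?_)
  · have := poissonWeight_pos hl n
    positivity
  · rw [← mul_add]
    exact mul_le_mul_of_nonneg_left (le_fisherTaylor_add hl hr (by positivity))
      (poissonWeight_pos hl n).le

lemma le_latentCoh_poissonWeight {l r : ℝ} (hl : 0 < l) (hr : 0 < r) :
    l * (1 - r) ^ 2 / (1 + r) + (r - 4 * r / (1 + r) ^ 2 +
        4 * r ^ 2 * (1 + l⁻¹) / (1 + r) ^ 3 -
          4 * r ^ 3 * (4 * l⁻¹ + l⁻¹ ^ 2) / (1 + r) ^ 4) ≤ latentCoh r (poissonWeight l) :=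
  hasSum_le (fun n => mul_le_mul_of_nonneg_left (fisherTaylor_le hl hr (by positivity))
    (poissonWeight_pos hl n).le) (hasSum_poissonWeight_mul_fisherTaylor hl hr)
    (hasSum_latentCoh_poissonWeight hl hr)

lemma latentCoh_poissonWeight_le {l r : ℝ} (hl : 0 < l) (hr : 0 < r) :
    latentCoh r (poissonWeight l) ≤ l * (1 - r) ^ 2 / (1 + r) + (r - 4 * r / (1 + r) ^ 2 +
        4 * r ^ 2 * (1 + l⁻¹) / (1 + r) ^ 3 -
          4 * r ^ 3 * (4 * l⁻¹ + l⁻¹ ^ 2) / (1 + r) ^ 4) +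
      4 * r ^ 4 * (3 * l⁻¹ + 11 * l⁻¹ ^ 2 + l⁻¹ ^ 3) / (1 + r) ^ 4 := by
  refine hasSum_le (fun n => ?_) (hasSum_latentCoh_poissonWeight hl hr)
    ((hasSum_poissonWeight_mul_fisherTaylor hl hr).add (hasSum_poissonWeight_mul_remainder hl hr))
  rw [← mul_add]
  exact mul_le_mul_of_nonneg_left (le_fisherTaylor_add hl hr (by positivity))
    (poissonWeight_pos hl n).le

/-- Large-amplitude asymptotics of the latent coherence of Poisson statistics. -/
theorem latentCoh_poisson_asymptotic (r : ℝ) (hr0 : 0 < r) (hr1 : r ≤ 1) :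
    Tendsto
      (fun l : ℝ =>
        latentCoh r (fun n => Real.exp (-l) * l ^ n / (Nat.factorial n)) -
          l * (1 - r) ^ 2 / (1 + r))
      atTop (nhds (r * (1 - 4 / (1 + r) ^ 3))) := by
  have h' : 1 + r ≠ 0 := by positivity
  have limit_lower : Tendsto (fun l : ℝ => r - 4 * r / (1 + r) ^ 2 +
        4 * r ^ 2 * (1 + l⁻¹) / (1 + r) ^ 3 - 4 * r ^ 3 * (4 * l⁻¹ + l⁻¹ ^ 2) / (1 + r) ^ 4)
      atTop (nhds (r * (1 - 4 / (1 + r) ^ 3))) := by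
    have hc : Continuous (fun t : ℝ => r - 4 * r / (1 + r) ^ 2 +
        4 * r ^ 2 * (1 + t) / (1 + r) ^ 3 - 4 * r ^ 3 * (4 * t + t ^ 2) / (1 + r) ^ 4) := by
      fun_prop
    convert (hc.tendsto 0).comp tendsto_inv_atTop_zero using 2
    · rfl
    field_simp
    ring
  have limit_error : Tendsto (fun l : ℝ =>
      4 * r ^ 4 * (3 * l⁻¹ + 11 * l⁻¹ ^ 2 + l⁻¹ ^ 3) / (1 + r) ^ 4) atTop (nhds 0) := by
    have hc : Continuous (fun t : ℝ =>
        4 * r ^ 4 * (3 * t + 11 * t ^ 2 + t ^ 3) / (1 + r) ^ 4) := by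
      fun_prop
    convert (hc.tendsto 0).comp tendsto_inv_atTop_zero using 2
    · rfl
    simp
  have limit_upper := limit_lower.add limit_error
  rw [add_zero] at limit_upper
  refine tendsto_of_tendsto_of_tendsto_of_le_of_le' limit_lower limit_upper ?_ ?_
  · filter_upwards [eventually_gt_atTop 0] with l hl
    exact le_sub_iff_add_le'.mpr (le_latentCoh_poissonWeight hl hr0)
  · filter_upwards [eventually_gt_atTop 0] with l hl
    rw [sub_le_iff_le_add', ← add_assoc]
    exact latentCoh_poissonWeight_le hl hr0
end

section
/- Spread bound for Hermitian matrices via orthonormal off-diagonal elements: let h be an n×n Hermitian complex matrix and let w, z ∈ ℂⁿ be vectors with ‖w‖ = ‖z‖ = 1 and ⟨w, z⟩ = 0. Then λ_max(h) − λ_min(h) ≥ 2·|⟨w, h·z⟩|, where λ_max(h) and λ_min(h) are the largest and smallest eigenvalues of h. -/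
open scoped ComplexOrder

/-- The off-diagonal bound for an operator that is diagonal in an orthonormal basis, with
all its eigenvalues in the interval `[m, M]`. -/
theorem OrthonormalBasis.two_mul_norm_inner_le_of_eigenvalues_mem_Icc
    {𝕜 E ι : Type*} [RCLike 𝕜] [NormedAddCommGroup E] [InnerProductSpace 𝕜 E] [Fintype ι]
    (b : OrthonormalBasis ι 𝕜 E) {T : E →ₗ[𝕜] E} (hT : T.IsSymmetric) {μ : ι → ℝ}
    (hb : ∀ i, T (b i) = (μ i : 𝕜) • b i) {m M : ℝ} (hμ : ∀ i, μ i ∈ Set.Icc m M)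
    {x y : E} (hx : ‖x‖ = 1) (hy : ‖y‖ = 1) (hxy : inner 𝕜 x y = 0) :
    2 * ‖inner 𝕜 x (T y)‖ ≤ M - m := by
  have hcoord (i : ι) : inner 𝕜 (b i) (T y) = (μ i : 𝕜) * inner 𝕜 (b i) y := by
    rw [← hT, hb, inner_smul_left, RCLike.conj_ofReal]
  have hcentre : inner 𝕜 x (T y) =
      ∑ i, ((μ i - (M + m) / 2 : ℝ) : 𝕜) * (inner 𝕜 x (b i) * inner 𝕜 (b i) y) := by
    simp only [RCLike.ofReal_sub, sub_mul, Finset.sum_sub_distrib, ← Finset.mul_sum,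
      b.sum_inner_mul_inner, hxy, mul_zero, sub_zero]
    rw [← b.sum_inner_mul_inner x (T y)]
    refine Finset.sum_congr rfl fun i _ => ?_
    rw [hcoord]
    ring
  have hterm (i : ι) :
      ‖((μ i - (M + m) / 2 : ℝ) : 𝕜) * (inner 𝕜 x (b i) * inner 𝕜 (b i) y)‖ ≤
        (M - m) / 4 * (‖inner 𝕜 x (b i)‖ ^ 2 + ‖inner 𝕜 (b i) y‖ ^ 2) := by
    obtain ⟨hm, hM⟩ := hμ i
    have habs : |μ i - (M + m) / 2| ≤ (M - m) / 2 := abs_le.2 ⟨by linarith, by linarith⟩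
    rw [norm_mul, norm_mul, RCLike.norm_ofReal]
    calc _ ≤ (M - m) / 2 * (‖inner 𝕜 x (b i)‖ * ‖inner 𝕜 (b i) y‖) := by gcongr
      _ ≤ _ := by
        nlinarith [mul_nonneg (sub_nonneg.2 (hm.trans hM))
          (sq_nonneg (‖inner 𝕜 x (b i)‖ - ‖inner 𝕜 (b i) y‖))]
  have hsum : ‖inner 𝕜 x (T y)‖ ≤ (M - m) / 4 * (1 + 1) := by
    rw [hcentre]
    refine (norm_sum_le_of_le _ fun i _ => hterm i).trans_eq ?_
    rw [← Finset.mul_sum, Finset.sum_add_distrib, b.sum_sq_norm_inner_left,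
      b.sum_sq_norm_inner_right, hx, hy, one_pow]
  linarith

/-- Spread bound for Hermitian matrices: if `w, z` are orthonormal vectors, then
`λ_max(h) − λ_min(h) ≥ 2 |⟨w, h z⟩|`. -/
theorem spread_ge_two_offdiag (n : ℕ) (hn : 0 < n)
    (h : Matrix (Fin n) (Fin n) ℂ) (hh : h.IsHermitian)
    (w z : Fin n → ℂ)
    (hw : ∑ i, ‖w i‖ ^ 2 = 1) (hz : ∑ i, ‖z i‖ ^ 2 = 1)
    (horth : ∑ i, star (w i) * z i = 0) :
    (⨆ i, hh.eigenvalues i) - (⨅ i, hh.eigenvalues i) ≥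
      2 * ‖∑ i, star (w i) * (h.mulVec z) i‖ := by
  have hinner (x y : Fin n → ℂ) :
      inner ℂ (WithLp.toLp 2 x) (WithLp.toLp 2 y) = ∑ i, star (x i) * y i := by
    simp [PiLp.inner_apply, mul_comm]
  have hnorm {x : Fin n → ℂ} (hx : ∑ i, ‖x i‖ ^ 2 = 1) : ‖WithLp.toLp 2 x‖ = 1 := by
    simp [EuclideanSpace.norm_eq, hx]
  rw [← hinner w, ← Matrix.toLin'_apply, ← Matrix.toLpLin_toLp]
  refine hh.eigenvectorBasis.two_mul_norm_inner_le_of_eigenvalues_mem_Icc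
    (Matrix.isSymmetric_toEuclideanLin_iff.2 hh) (μ := hh.eigenvalues) (fun i => ?_)
    (fun i => ⟨ciInf_le (Set.finite_range _).bddBelow i, le_ciSup (Set.finite_range _).bddAbove i⟩)
    (hnorm hw) (hnorm hz) ((hinner w z).trans horth)
  ext j
  simpa using congrFun (hh.mulVec_eigenvectorBasis i) j
end

section
/- Nonlinear nonclassicality witness for Poisson-mixture statistics: let μ be a probability measure on [0,∞) with finite k-th moment, define p_n := ∫ e^{−λ}·λⁿ/n! dμ(λ), and let 0 < r ≤ 1 and k ≥ 1. Then ∑_{n≥k} f(p_n, r^k·p_{n−k})·n_(k) ≤ ∑_n p_n·n_(k) + r^k·( ∑_n p_n·(n+1)^{(k)} − 2·∑_n p_n·n_(k) ), where n_(k) = n(n−1)⋯(n−k+1) is the falling factorial and (n+1)^{(k)} = (n+1)(n+2)⋯(n+k) is the rising factorial. -/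
open MeasureTheory

/-- The weights `exp (-x) * x ^ n` are bounded on `[0, ∞)`, hence integrable. -/
theorem integrable_exp_neg_mul_pow (μ : Measure ℝ) [IsFiniteMeasure μ]
    (hpos : ∀ᵐ x ∂μ, 0 ≤ x) (n : ℕ) : Integrable (fun x => Real.exp (-x) * x ^ n) μ := by
  refine Integrable.of_bound (C := n.factorial) (by fun_prop) ?_
  filter_upwards [hpos] with x hx
  rw [Real.norm_of_nonneg (by positivity), Real.exp_neg, inv_mul_le_iff₀ (Real.exp_pos x)]
  have h := Real.pow_div_factorial_le_exp x hx n
  rwa [div_le_iff₀ (by positivity)] at h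

/-- Log-convexity of the exponentially damped moments. -/
theorem sq_integral_exp_neg_mul_pow_le (μ : Measure ℝ) [IsFiniteMeasure μ]
    (hpos : ∀ᵐ x ∂μ, 0 ≤ x) (n k : ℕ) :
    (∫ x, Real.exp (-x) * x ^ (n + k) ∂μ) ^ 2 ≤
      (∫ x, Real.exp (-x) * x ^ n ∂μ) * ∫ x, Real.exp (-x) * x ^ (n + k + k) ∂μ := by
  have hi := integrable_exp_neg_mul_pow μ hpos
  have h := discrim_le_zero (a := ∫ x, Real.exp (-x) * x ^ n ∂μ)
    (b := -2 * ∫ x, Real.exp (-x) * x ^ (n + k) ∂μ)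
    (c := ∫ x, Real.exp (-x) * x ^ (n + k + k) ∂μ) fun t => by
      have h0 : 0 ≤ ∫ x, (Real.exp (-x) * x ^ n * (t * t)
          + Real.exp (-x) * x ^ (n + k) * (-2 * t) + Real.exp (-x) * x ^ (n + k + k)) ∂μ := by
        refine integral_nonneg_of_ae ?_
        filter_upwards [hpos] with x hx
        have : 0 ≤ Real.exp (-x) * x ^ n * (t - x ^ k) ^ 2 := by positivity
        refine this.trans_eq ?_
        ring
      have h1 : Integrable (fun x => Real.exp (-x) * x ^ n * (t * t)
          + Real.exp (-x) * x ^ (n + k) * (-2 * t)) μ :=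
        ((hi _).mul_const _).add ((hi _).mul_const _)
      rw [integral_add h1 (hi _),
        integral_add ((hi _).mul_const _) ((hi _).mul_const _), integral_mul_const,
        integral_mul_const] at h0
      linarith
  unfold discrim at h
  linarith

/-- A Poisson mixture with finite `k`-th moment has summable `k`-th factorial moment. -/
theorem summable_integral_exp_neg_mul_pow_div_factorial (μ : Measure ℝ) [IsFiniteMeasure μ]
    (hpos : ∀ᵐ x ∂μ, 0 ≤ x) (k : ℕ) (hmom : Integrable (fun x => x ^ k) μ) :
    Summable fun n : ℕ => (∫ x, Real.exp (-x) * x ^ (n + k) ∂μ) / n.factorial := by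
  refine summable_of_sum_range_le (c := ∫ x, x ^ k ∂μ) (fun n => ?_) fun N => ?_
  · refine div_nonneg (integral_nonneg_of_ae ?_) (by positivity)
    filter_upwards [hpos] with x hx
    simp only [Pi.zero_apply]
    positivity
  · simp_rw [← integral_div]
    have hi : ∀ n ∈ Finset.range N,
        Integrable (fun x => Real.exp (-x) * x ^ (n + k) / n.factorial) μ :=
      fun n _ => (integrable_exp_neg_mul_pow μ hpos _).div_const _
    rw [← integral_finsetSum _ hi]
    refine integral_mono_ae (integrable_finsetSum _ hi) hmom ?_
    filter_upwards [hpos] with x hx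
    have h := Real.sum_le_exp_of_nonneg hx N
    calc ∑ n ∈ Finset.range N, Real.exp (-x) * x ^ (n + k) / n.factorial
        = Real.exp (-x) * x ^ k * ∑ n ∈ Finset.range N, x ^ n / n.factorial := by
          rw [Finset.mul_sum]
          exact Finset.sum_congr rfl fun n _ => by ring
      _ ≤ Real.exp (-x) * x ^ k * Real.exp x := by gcongr
      _ = x ^ k := by
          rw [mul_right_comm, ← Real.exp_add]
          simp

/-- The tangent-line bound at `x = y` for the harmonic mean, phrased for `fisherDiff`. -/
theorem fisherDiff_mul_le {a b c d R : ℝ} (ha : 0 ≤ a) (hb : 0 ≤ b) (hc : 0 ≤ c) (hd : 0 ≤ d)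
    (hR : 0 < R) (h : a ^ 2 * c ≤ b * d) :
    fisherDiff a (R * b) * c ≤ a * c + R * (b * c) - 4 * R * (a * c) + R * d + R ^ 2 * (a * c) := by
  unfold fisherDiff
  rcases hb.eq_or_lt with rfl | hb
  · have hac : a * c = 0 := by
      have : (a * c) ^ 2 ≤ 0 := by nlinarith
      exact pow_eq_zero_iff two_ne_zero |>.1 (le_antisymm this (sq_nonneg _))
    have h0 : (a - R * 0) ^ 2 / (a + R * 0) * c = 0 := by
      rw [mul_zero, sub_zero, add_zero, div_mul_eq_mul_div, pow_two, mul_assoc, hac]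
      simp
    rw [h0, hac]
    nlinarith [mul_nonneg hR.le hd]
  · have hab : 0 < a + R * b := by positivity
    have h1 : a ^ 2 * c / b ≤ d := by rw [div_le_iff₀ hb]; linarith
    have h2 : (a - R * b) ^ 2 / (a + R * b) * c ≤
        a * c + R * (b * c) - 4 * R * (a * c) + R * (a ^ 2 * c / b) + R ^ 2 * (a * c) := by
      have key : a * c + R * (b * c) - 4 * R * (a * c) + R * (a ^ 2 * c / b) + R ^ 2 * (a * c)
          - (a - R * b) ^ 2 / (a + R * b) * c
          = R * a * c * (a + R * b - 2 * b) ^ 2 / (b * (a + R * b)) := by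
        field_simp
        ring
      have : 0 ≤ R * a * c * (a + R * b - 2 * b) ^ 2 / (b * (a + R * b)) := by positivity
      linarith
    nlinarith [mul_le_mul_of_nonneg_left h1 hR.le]

/-- Nonlinear nonclassicality witness for Poisson-mixture (classical) photon
statistics, with `k`-photon exchange generators.  `Nat.descFactorial n k` is the
falling factorial `n_(k)` and `Nat.ascFactorial (n+1) k` is the rising factorial
`(n+1)^{(k)}`. -/
theorem nonlinear_witness_classical (μ : Measure ℝ) [IsProbabilityMeasure μ]
    (hpos : ∀ᵐ x ∂μ, 0 ≤ x) (k : ℕ) (hk : 1 ≤ k)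
    (hmom : Integrable (fun x => x ^ k) μ)
    (r : ℝ) (hr0 : 0 < r) (hr1 : r ≤ 1)
    (p : ℕ → ℝ) (hp : ∀ n, p n = ∫ x, Real.exp (-x) * x ^ n / (Nat.factorial n) ∂μ) :
    (∑' n : ℕ, fisherDiff (p (n + k)) (r ^ k * p n) * (Nat.descFactorial (n + k) k : ℝ)) ≤
      (∑' n : ℕ, p n * (Nat.descFactorial n k : ℝ)) +
        r ^ k * ((∑' n : ℕ, p n * (Nat.ascFactorial (n + 1) k : ℝ)) -
          2 * ∑' n : ℕ, p n * (Nat.descFactorial n k : ℝ)) := by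
  set m : ℕ → ℝ := fun n => ∫ x, Real.exp (-x) * x ^ n ∂μ with hm
  have hm0 : ∀ n, 0 ≤ m n := fun n => by
    refine integral_nonneg_of_ae ?_
    filter_upwards [hpos] with x hx
    simp only [Pi.zero_apply]
    positivity
  have hpm : ∀ n, p n = m n / n.factorial := fun n => by rw [hp, integral_div]
  have hp0 : ∀ n, 0 ≤ p n := fun n => by rw [hpm]; exact div_nonneg (hm0 n) (by positivity)
  have hfac : ∀ n : ℕ, (n.factorial : ℝ) * (n + k).descFactorial k = (n + k).factorial := by
    intro n
    have := Nat.factorial_mul_descFactorial (Nat.le_add_left k n)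
    rw [Nat.add_sub_cancel] at this
    exact_mod_cast this
  have hd : ∀ n, p (n + k) * ((n + k).descFactorial k : ℝ) = m (n + k) / n.factorial := by
    intro n
    have hk0 : ((n + k).descFactorial k : ℝ) ≠ 0 := fun h0 => by
      have := hfac n
      rw [h0, mul_zero] at this
      exact (n + k).factorial_ne_zero (by exact_mod_cast this.symm)
    rw [hpm, ← hfac]
    field_simp
  set D : ℕ → ℝ := fun n => p n * (n.descFactorial k : ℝ) with hD
  set E : ℕ → ℝ := fun n => p n * ((n + 1).ascFactorial k : ℝ) with hE
  have hD0 : ∀ n, 0 ≤ D n := fun n => mul_nonneg (hp0 n) (by positivity)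
  have hE0 : ∀ n, 0 ≤ E n := fun n => mul_nonneg (hp0 n) (by positivity)
  have hDk : Summable fun n => D (n + k) := by
    simp only [hD, hd]
    exact summable_integral_exp_neg_mul_pow_div_factorial μ hpos k hmom
  have hDs : Summable D := (summable_nat_add_iff k).1 hDk
  have hDkk : Summable fun n => D (n + k + k) := (summable_nat_add_iff k).2 hDk
  have hS1 : ∑' n, D (n + k) = ∑' n, D n := by
    rw [← hDs.sum_add_tsum_nat_add k, Finset.sum_eq_zero, zero_add]
    intro i hi
    simp [hD, Nat.descFactorial_of_lt (Finset.mem_range.1 hi)]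
  have hS2 : ∑' n, D (n + k + k) ≤ ∑' n, D n := by
    rw [← hS1, ← hDk.sum_add_tsum_nat_add k]
    exact le_add_of_nonneg_left (Finset.sum_nonneg fun i _ => hD0 _)
  have hEs : Summable E := by
    rw [← summable_nat_add_iff k]
    refine Summable.of_nonneg_of_le (fun n => hE0 _) (fun n => ?_)
      (hDk.mul_left (((2 * k) ^ k : ℕ) : ℝ))
    have hnat : (n + k + 1).ascFactorial k ≤ (2 * k) ^ k * (n + k).descFactorial k := by
      refine (Nat.ascFactorial_le_pow_add (n + k) k).trans ?_
      refine le_trans ?_ (Nat.mul_le_mul_left _ (Nat.pow_sub_le_descFactorial (n + k) k))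
      rw [← mul_pow]
      refine Nat.pow_le_pow_left ?_ k
      have : n + k + 1 - k = n + 1 := by omega
      rw [this]
      nlinarith
    have hreal : ((n + k + 1).ascFactorial k : ℝ) ≤
        (((2 * k) ^ k : ℕ) : ℝ) * ((n + k).descFactorial k : ℝ) := by exact_mod_cast hnat
    calc E (n + k) ≤ p (n + k) * ((((2 * k) ^ k : ℕ) : ℝ) * ((n + k).descFactorial k : ℝ)) :=
          mul_le_mul_of_nonneg_left hreal (hp0 _)
      _ = _ := by simp only [hD]; ring
  have hR0 : 0 < r ^ k := pow_pos hr0 k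
  have hR1 : r ^ k ≤ 1 := pow_le_one₀ hr0.le hr1
  set R := r ^ k
  have hterm : ∀ n, fisherDiff (p (n + k)) (R * p n) * ((n + k).descFactorial k : ℝ) ≤
      D (n + k) + R * E n - 4 * R * D (n + k) + R * D (n + k + k) + R ^ 2 * D (n + k) := by
    intro n
    have hEn : E n = p n * ((n + k).descFactorial k : ℝ) := by
      simp only [hE, Nat.add_descFactorial_eq_ascFactorial]
    rw [hEn]
    refine fisherDiff_mul_le (hp0 _) (hp0 _) (by positivity) (hD0 _) hR0 ?_
    have hlog : m (n + k) ^ 2 ≤ m n * m (n + k + k) :=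
      sq_integral_exp_neg_mul_pow_le μ hpos n k
    have hl : p (n + k) ^ 2 * ((n + k).descFactorial k : ℝ)
        = m (n + k) ^ 2 / (n.factorial * (n + k).factorial) := by
      rw [pow_two, mul_assoc, hd, hpm]
      ring
    have hr : p n * D (n + k + k) = m n * m (n + k + k) / (n.factorial * (n + k).factorial) := by
      simp only [hD]
      rw [hd, hpm]
      ring
    rw [hl, hr]
    gcongr
  have hsum : HasSum (fun n =>
      D (n + k) + R * E n - 4 * R * D (n + k) + R * D (n + k + k) + R ^ 2 * D (n + k))
      (∑' n, D (n + k) + R * ∑' n, E n - 4 * R * ∑' n, D (n + k) + R * ∑' n, D (n + k + k)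
        + R ^ 2 * ∑' n, D (n + k)) :=
    (((hDk.hasSum.add (hEs.hasSum.mul_left R)).sub (hDk.hasSum.mul_left (4 * R))).add
      (hDkk.hasSum.mul_left R)).add (hDk.hasSum.mul_left (R ^ 2))
  have hF0 : ∀ n, 0 ≤ fisherDiff (p (n + k)) (R * p n) * ((n + k).descFactorial k : ℝ) :=
    fun n => mul_nonneg (div_nonneg (sq_nonneg _)
      (add_nonneg (hp0 _) (mul_nonneg hR0.le (hp0 _)))) (by positivity)
  refine ((Summable.of_nonneg_of_le hF0 hterm hsum.summable).tsum_le_tsum hterm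
    hsum.summable).trans ?_
  rw [hsum.tsum_eq, hS1]
  have hS0 : 0 ≤ ∑' n, D n := tsum_nonneg hD0
  nlinarith [mul_le_mul_of_nonneg_left hS2 hR0.le,
    mul_nonneg (mul_nonneg hR0.le hS0) (sub_nonneg.2 hR1)]
end
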